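/- Let n > 2, and regard the permutations w_k^{(n−1,1)} as elements of S_n. Then in ℤ[x_1, …, x_n]: 𝔖_{s_1} · 𝔖_{w_1^{(n−1,1)}} = 𝔖_{w_1^{(n−1,1)} t_{1,n}}, and for each k with 2 ≤ k ≤ n−2, 𝔖_{s_1} · 𝔖_{w_k^{(n−1,1)}} = 𝔖_{w_k^{(n−1,1)} t_{1,n−k}}. -/

import Mathlib

open MvPolynomial Finset

/-- The product of simple transpositions `s_a s_{a-1} ⋯ s_b` (descending indices),
where `s_r` interchanges `r` and `r+1`; the empty product (when `a < b`) is the identity. -/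
def sdesc (a b : ℕ) : Equiv.Perm ℕ :=
  (((List.range' b (a + 1 - b)).reverse).map (fun r => Equiv.swap r (r + 1))).prod

/-- The product of simple transpositions `s_a s_{a+1} ⋯ s_b` (ascending indices);
the empty product (when `b < a`) is the identity. -/
def sasc (a b : ℕ) : Equiv.Perm ℕ :=
  ((List.range' a (b + 1 - a)).map (fun r => Equiv.swap r (r + 1))).prod

/-- The permutation `w_k^{(i,j)} = (s_{i-k} s_{i-k-1} ⋯ s_j)(s_{i-k+1} s_{i-k+2} ⋯ s_{i-1})`,
regarded as a permutation of `ℕ` (supported on `{1, …, n}`). -/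
def wkij (i j k : ℕ) : Equiv.Perm ℕ := sdesc (i - k) j * sasc (i - k + 1) (i - 1)

/-- The longest element `w_0 = [n, n-1, …, 1]` of `S_n`, as a permutation of `ℕ`. -/
def revPerm (n : ℕ) : Equiv.Perm ℕ :=
  Function.Involutive.toPerm (fun x => if 1 ≤ x ∧ x ≤ n then n + 1 - x else x)
    (fun x => by simp only; split_ifs <;> omega)

/-- One-line notation of the dominant permutation obtained from
`[p+1, …, n, p, p-1, …, 1]` by moving the entry `p` to position `j + 1`. -/
def domEntry (n p j x : ℕ) : ℕ :=
  if x < 1 then x else if n < x then x else if x ≤ j then p + x else if x = j + 1 then p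
  else if x ≤ n - p + 1 then p + x - 1 else n + 1 - x

/-- The monomial whose exponents form the Lehmer code of `domEntry n p j`. -/
noncomputable def domMonomial (n p j : ℕ) : MvPolynomial ℕ ℤ :=
  ∏ r ∈ Finset.Icc 1 n, X r ^ (if r ≤ j then p else min (p - 1) (n - r))

theorem domMonomial_succ {n p j : ℕ} (hp : 1 ≤ p) (hj : j + 1 ≤ n - p) :
    domMonomial n p (j + 1) = X (j + 1) * domMonomial n p j := by
  have hmem : j + 1 ∈ Finset.Icc 1 n := by simp; omega
  unfold domMonomial
  rw [← Finset.mul_prod_erase _ _ hmem, ← Finset.mul_prod_erase _ _ hmem, ← mul_assoc]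
  congr 1
  · rw [if_pos le_rfl, if_neg (by omega), min_eq_left (by omega), ← pow_succ']
    congr 1
    omega
  · refine Finset.prod_congr rfl fun r hr => ?_
    have : r ≠ j + 1 := Finset.ne_of_mem_erase hr
    congr 1
    split_ifs <;> omega

theorem rename_swap_domMonomial {n p j : ℕ} (hp : 1 ≤ p) (hj : j + 1 ≤ n - p) :
    rename (⇑(Equiv.swap (j + 1) (j + 1 + 1))) (domMonomial n p j) = domMonomial n p j := by
  unfold domMonomial
  rw [map_prod]
  refine Finset.prod_equiv (Equiv.swap (j + 1) (j + 1 + 1)) (fun r => ?_) (fun r _ => ?_)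
  · simp only [Finset.mem_Icc, Equiv.swap_apply_def]
    split_ifs <;> omega
  · rw [map_pow, rename_X]
    congr 1
    simp only [Equiv.swap_apply_def]
    split_ifs <;> omega

theorem X_sub_X_ne_zero {a b : ℕ} (h : a ≠ b) : (X a - X b : MvPolynomial ℕ ℤ) ≠ 0 :=
  sub_ne_zero.mpr fun e => h (X_injective e)

/-- `S` satisfies the divided difference recursion of the Schubert polynomials of `S_n`. -/
def SchubertRec (n : ℕ) (S : Equiv.Perm ℕ → MvPolynomial ℕ ℤ) : Prop :=
  ∀ w : Equiv.Perm ℕ, (∀ x, x ∉ Finset.Icc 1 n → w x = x) →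
    ∀ r, 1 ≤ r → r < n → w (r + 1) < w r →
      S w - rename (⇑(Equiv.swap r (r + 1))) (S w)
        = (X r - X (r + 1)) * S (w * Equiv.swap r (r + 1))

/-- The Schubert polynomial of each permutation `domEntry n p j` is a monomial. -/
theorem SchubertRec.eq_domMonomial {n : ℕ} {S : Equiv.Perm ℕ → MvPolynomial ℕ ℤ}
    (hS : SchubertRec n S)
    (hS0 : S (revPerm n) = ∏ r ∈ Finset.Icc 1 (n - 1), X r ^ (n - r)) {p j : ℕ}
    (hp : 1 ≤ p) (hpn : p ≤ n) (hj : j ≤ n - p)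
    (w : Equiv.Perm ℕ) (hw : ∀ x, w x = domEntry n p j x) : S w = domMonomial n p j := by
  induction hpn using Nat.decreasingInduction generalizing j w with
  | self =>
    obtain rfl : j = 0 := by omega
    have hw0 : w = revPerm n := by
      ext x
      have hrev : revPerm n x = if 1 ≤ x ∧ x ≤ n then n + 1 - x else x := rfl
      rw [hw, hrev]
      simp only [domEntry]
      split_ifs <;> omega
    obtain ⟨m, rfl⟩ : ∃ m, n = m + 1 := ⟨n - 1, by omega⟩
    rw [hw0, hS0, domMonomial, Finset.prod_Icc_succ_top (by omega)]
    simp only [Nat.add_sub_cancel]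
    rw [if_neg (by omega), Nat.sub_self, Nat.min_zero, pow_zero, mul_one]
    refine Finset.prod_congr rfl fun r hr => ?_
    rw [Finset.mem_Icc] at hr
    congr 1
    split_ifs <;> omega
  | of_succ p hpn ih =>
    induction hj using Nat.decreasingInduction generalizing w with
    | self =>
      rw [ih (j := 0) (by omega) (by omega) w fun x => ?_]
      · refine Finset.prod_congr rfl fun r hr => ?_
        rw [Finset.mem_Icc] at hr
        congr 1
        split_ifs <;> omega
      · rw [hw]
        simp only [domEntry]
        split_ifs <;> omega
    | of_succ j hj ihj =>
      have hu : ∀ x, (w * Equiv.swap (j + 1) (j + 1 + 1)) x = domEntry n p (j + 1) x := by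
        intro x
        rw [Equiv.Perm.mul_apply, hw, Equiv.swap_apply_def]
        simp only [domEntry]
        split_ifs <;> omega
      have key := hS (w * Equiv.swap (j + 1) (j + 1 + 1)) (fun x hx => by
        rw [Finset.mem_Icc] at hx
        rw [hu]
        simp only [domEntry]
        split_ifs <;> omega) (j + 1) (by omega) (by omega) (by
        rw [hu, hu]
        simp only [domEntry]
        split_ifs <;> omega)
      rw [ihj _ hu, mul_assoc, Equiv.swap_mul_self, mul_one, domMonomial_succ hp hj, map_mul,
        rename_X, rename_swap_domMonomial hp hj, Equiv.swap_apply_left, ← sub_mul] at key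
      exact (mul_left_cancel₀ (X_sub_X_ne_zero (by omega)) key).symm

theorem eq_self_of_lt_succ {n : ℕ} {g : ℕ → ℕ} (h1 : 1 ≤ g 1) (hn : g n ≤ n)
    (h : ∀ i, 1 ≤ i → i < n → g i < g (i + 1)) {x : ℕ} (hx1 : 1 ≤ x) (hxn : x ≤ n) :
    g x = x := by
  have lower : x ≤ g x := by
    induction x, hx1 using Nat.le_induction with
    | base => exact h1
    | succ i hi ih =>
      have := h i hi (by omega)
      have := ih (by omega)
      omega
  have upper : g x ≤ x := by
    clear lower
    induction hxn using Nat.decreasingInduction with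
    | self => exact hn
    | of_succ i hi ih =>
      have := h i hx1 hi
      have := ih (by omega)
      omega
  omega

/-- If the entries exceeding `w 1` occur in increasing order, and no ascent of `w` after the
first position starts with an entry below `w 1`, then `w` is dominant. -/
theorem apply_eq_domEntry {n : ℕ} {w : Equiv.Perm ℕ} (hn : 1 ≤ n)
    (hfix : ∀ x, x ∉ Finset.Icc 1 n → w x = x)
    (hinc : ∀ x y, x < y → y ≤ n → w 1 < w x → w 1 < w y → w x < w y)
    (hmax : ∀ i, 2 ≤ i → i < n → w i < w 1 → w (i + 1) < w i) (x : ℕ) :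
    w x = domEntry n (w 1) 0 x := by
  have hrange : ∀ x, 1 ≤ x → x ≤ n → 1 ≤ w x ∧ w x ≤ n := by
    intro x hx1 hxn
    by_contra hc
    have h := hfix (w x) (by rw [Finset.mem_Icc]; exact hc)
    have := w.injective h
    omega
  have hinj : ∀ x, w x = w 1 → x = 1 := fun x h => w.injective h
  set p := w 1 with hp
  by_cases hx : 1 ≤ x ∧ x ≤ n
  swap
  · rw [hfix x (by rw [Finset.mem_Icc]; exact hx)]
    simp only [domEntry]
    split_ifs <;> omega
  have hg : (fun x => if p ≤ w x then w x + 1 - p else n + 1 - w x) x = x := by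
    refine eq_self_of_lt_succ (n := n)
      (g := fun x => if p ≤ w x then w x + 1 - p else n + 1 - w x) ?_ ?_ (fun i hi1 hin => ?_) hx.1 hx.2
    · simp only [← hp]
      have := hrange 1 le_rfl hn
      split_ifs <;> omega
    · have := hrange n hn le_rfl
      have := hrange 1 le_rfl hn
      split_ifs <;> omega
    · have := hrange i hi1 hin.le
      have := hrange (i + 1) (by omega) hin
      have h3 := hinc i (i + 1) (by omega) hin
      have h4 := hinj i
      have h5 := hinj (i + 1)
      have h6 := fun h => hmax i h hin
      have h7 : i = 1 → w i = p := by rintro rfl; rfl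
      split_ifs <;> omega
  have := hrange x hx.1 hx.2
  have := hrange 1 le_rfl hn
  have h4 := hinj x
  have h7 : x = 1 → w x = p := by rintro rfl; rfl
  dsimp only at hg
  simp only [domEntry]
  split_ifs at hg ⊢ <;> omega

theorem sum_mul_apply_swap_lt {n i : ℕ} {w : Equiv.Perm ℕ} (hi : 1 ≤ i) (hin : i < n)
    (hlt : w i < w (i + 1)) :
    ∑ x ∈ Finset.Icc 1 n, x * (w * Equiv.swap i (i + 1)) x < ∑ x ∈ Finset.Icc 1 n, x * w x := by
  have hi' : i ∈ Finset.Icc 1 n := by simp; omega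
  have hi'' : i + 1 ∈ (Finset.Icc 1 n).erase i := by simp; omega
  rw [← Finset.add_sum_erase _ _ hi', ← Finset.add_sum_erase _ _ hi'',
    ← Finset.add_sum_erase _ (fun x => x * w x) hi', ← Finset.add_sum_erase _ _ hi'']
  have hrest : ∑ x ∈ ((Finset.Icc 1 n).erase i).erase (i + 1),
        x * (w * Equiv.swap i (i + 1)) x
      = ∑ x ∈ ((Finset.Icc 1 n).erase i).erase (i + 1), x * w x := by
    refine Finset.sum_congr rfl fun x hx => ?_
    simp only [Finset.mem_erase] at hx
    rw [Equiv.Perm.mul_apply, Equiv.swap_apply_of_ne_of_ne hx.2.1 hx.1]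
  rw [hrest, Equiv.Perm.mul_apply, Equiv.Perm.mul_apply, Equiv.swap_apply_left,
    Equiv.swap_apply_right]
  nlinarith

/-- Monk's rule for `x_1` when only one cover occurs: if the entries exceeding `w 1` occur in
increasing order, multiplication by `x_1` raises the first entry by one. -/
theorem SchubertRec.X_one_mul {n : ℕ} {S : Equiv.Perm ℕ → MvPolynomial ℕ ℤ}
    (hS : SchubertRec n S)
    (hS0 : S (revPerm n) = ∏ r ∈ Finset.Icc 1 (n - 1), X r ^ (n - r)) {p : ℕ}
    (hp1 : 1 ≤ p) (hpn : p < n) (w : Equiv.Perm ℕ) (hw1 : w 1 = p)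
    (hfix : ∀ x, x ∉ Finset.Icc 1 n → w x = x)
    (hinc : ∀ x y, x < y → y ≤ n → p < w x → p < w y → w x < w y) :
    X 1 * S w = S (Equiv.swap p (p + 1) * w) := by
  induction hN : ∑ x ∈ Finset.Icc 1 n, x * w x using Nat.strong_induction_on generalizing w with
  | _ N ih =>
  have hinj : ∀ x, w x = p → x = 1 := fun x h => w.injective (h.trans hw1.symm)
  by_cases hex : ∃ i, 2 ≤ i ∧ i < n ∧ w i < p ∧ w i < w (i + 1)
  · obtain ⟨i, hi2, hin, hip, hlt⟩ := hex
    set u := w * Equiv.swap i (i + 1) with hu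
    have hui : u i = w (i + 1) := by simp [hu]
    have hui' : u (i + 1) = w i := by simp [hu]
    have huw : u * Equiv.swap i (i + 1) = w := by
      rw [hu, mul_assoc, Equiv.swap_mul_self, mul_one]
    have hufix : ∀ x, x ∉ Finset.Icc 1 n → u x = x := by
      intro x hx
      have hx' := hx
      rw [Finset.mem_Icc] at hx'
      rw [hu, Equiv.Perm.mul_apply, Equiv.swap_apply_of_ne_of_ne (by omega) (by omega), hfix x hx]
    have hrec : X 1 * S u = S (Equiv.swap p (p + 1) * u) := by
      refine ih _ (hN ▸ sum_mul_apply_swap_lt (by omega) hin hlt) u ?_ hufix ?_ rfl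
      · rw [hu, Equiv.Perm.mul_apply, Equiv.swap_apply_of_ne_of_ne (by omega) (by omega), hw1]
      · intro x y hxy hyn hx hy
        have hx' : x ≠ i + 1 := by rintro rfl; omega
        have hy' : y ≠ i + 1 := by rintro rfl; omega
        rw [hu, Equiv.Perm.mul_apply] at hx hy ⊢
        rw [Equiv.Perm.mul_apply]
        refine hinc _ _ ?_ ?_ hx hy <;>
        · simp only [Equiv.swap_apply_def]
          split_ifs <;> omega
    have h1 := hS u hufix i (by omega) hin (by omega)
    have h2 := hS (Equiv.swap p (p + 1) * u) (fun x hx => by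
        rw [Equiv.Perm.mul_apply, hufix x hx]
        rw [Finset.mem_Icc] at hx
        exact Equiv.swap_apply_of_ne_of_ne (by omega) (by omega)) i (by omega) hin (by
        have := hinj (i + 1)
        rw [Equiv.Perm.mul_apply, Equiv.Perm.mul_apply _ u, hui, hui']
        simp only [Equiv.swap_apply_def]
        split_ifs <;> omega)
    rw [mul_assoc, huw, ← hrec, map_mul, rename_X,
      Equiv.swap_apply_of_ne_of_ne (by omega) (by omega), ← mul_sub, h1, huw,
      mul_left_comm] at h2
    exact mul_left_cancel₀ (X_sub_X_ne_zero (by omega)) h2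
  · have hdom : ∀ x, w x = domEntry n p 0 x := by
      subst hw1
      refine apply_eq_domEntry (by omega) hfix hinc fun i hi2 hin hip => ?_
      by_contra hc
      have : w i ≠ w (i + 1) := fun h => by
        have := w.injective h
        omega
      exact hex ⟨i, hi2, hin, hip, by omega⟩
    rw [hS.eq_domMonomial hS0 hp1 hpn.le (Nat.zero_le _) w hdom,
      hS.eq_domMonomial hS0 (j := 1) hp1 hpn.le (by omega) _ fun x => ?_,
      domMonomial_succ hp1 (by omega)]
    rw [Equiv.Perm.mul_apply, hdom, Equiv.swap_apply_def]
    simp only [domEntry]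
    split_ifs <;> omega

theorem sdesc_one_apply (a x : ℕ) :
    sdesc a 1 x = if x = 1 then a + 1 else if 2 ≤ x ∧ x ≤ a + 1 then x - 1 else x := by
  simp only [sdesc, Nat.add_sub_cancel]
  induction a with
  | zero => simp; split_ifs <;> omega
  | succ a ih =>
    rw [List.range'_concat, List.reverse_append, List.map_append, List.prod_append,
      Equiv.Perm.mul_apply, ih]
    simp only [List.reverse_singleton, List.map_cons, List.map_nil, List.prod_singleton,
      Equiv.swap_apply_def]
    split_ifs <;> omega

theorem prod_swap_range'_apply (a m x : ℕ) :
    ((List.range' a m).map (fun r => Equiv.swap r (r + 1))).prod x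
      = if a ≤ x ∧ x < a + m then x + 1 else if x = a + m then a else x := by
  induction m generalizing x with
  | zero => simp; split_ifs <;> omega
  | succ m ih =>
    rw [List.range'_concat, List.map_append, List.prod_append, Equiv.Perm.mul_apply, ih]
    simp only [List.map_cons, List.map_nil, List.prod_singleton, Equiv.swap_apply_def]
    split_ifs <;> omega

theorem wkij_apply {n k : ℕ} (hk : 1 ≤ k) (hkn : k + 2 ≤ n) (x : ℕ) :
    wkij (n - 1) 1 k x = if x = 1 then n - k else if 2 ≤ x ∧ x + k + 1 ≤ n then x - 1
      else if n ≤ x + k ∧ x + 2 ≤ n then x + 1 else if x + 1 = n then n - k - 1 else x := by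
  rw [wkij, Equiv.Perm.mul_apply, sasc, prod_swap_range'_apply, sdesc_one_apply]
  split_ifs <;> omega

/-- Multiplying the Schubert polynomial of `w_k^{(n-1,1)}` by `x_1`. -/
theorem SchubertRec.X_one_mul_wkij {n k q : ℕ} {S : Equiv.Perm ℕ → MvPolynomial ℕ ℤ}
    (hS : SchubertRec n S)
    (hS0 : S (revPerm n) = ∏ r ∈ Finset.Icc 1 (n - 1), X r ^ (n - r))
    (hk : 1 ≤ k) (hkn : k + 2 ≤ n) (hq : wkij (n - 1) 1 k q = n - k + 1) :
    X 1 * S (wkij (n - 1) 1 k) = S (wkij (n - 1) 1 k * Equiv.swap 1 q) := by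
  have h1 : wkij (n - 1) 1 k 1 = n - k := by rw [wkij_apply hk hkn, if_pos rfl]
  rw [Equiv.mul_swap_eq_swap_mul, h1, hq]
  refine hS.X_one_mul hS0 (by omega) (by omega) _ h1 (fun x hx => ?_) fun x y hxy hyn => ?_
  · rw [Finset.mem_Icc] at hx
    rw [wkij_apply hk hkn]
    split_ifs <;> omega
  · rw [wkij_apply hk hkn, wkij_apply hk hkn]
    split_ifs <;> omega

theorem SchubertRec.swap_one_two {n : ℕ} {S : Equiv.Perm ℕ → MvPolynomial ℕ ℤ}
    (hS : SchubertRec n S)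
    (hS0 : S (revPerm n) = ∏ r ∈ Finset.Icc 1 (n - 1), X r ^ (n - r)) (hn : 2 ≤ n) :
    S (Equiv.swap 1 2) = X 1 := by
  have hone : S 1 = 1 := by
    rw [hS.eq_domMonomial hS0 (p := 1) (j := 0) le_rfl (by omega) (Nat.zero_le _) 1 fun x => ?_]
    · refine Finset.prod_eq_one fun r hr => ?_
      rw [Finset.mem_Icc] at hr
      rw [if_neg (by omega), Nat.sub_self, Nat.zero_min, pow_zero]
    · simp only [domEntry, Equiv.Perm.one_apply]
      split_ifs <;> omega
  have h := hS.X_one_mul hS0 (p := 1) le_rfl (by omega) 1 rfl (fun _ _ => rfl)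
    (fun x y hxy _ _ _ => hxy)
  rw [hone, mul_one, mul_one] at h
  exact h.symm

/-- Case (i) in the proof of Proposition 3.2.  For `n > 2`, in
`ℤ[x_1, …, x_n]`: `𝔖_{s_1} · 𝔖_{w_1^{(n-1,1)}} = 𝔖_{w_1^{(n-1,1)} t_{1,n}}`, and for
`2 ≤ k ≤ n-2`, `𝔖_{s_1} · 𝔖_{w_k^{(n-1,1)}} = 𝔖_{w_k^{(n-1,1)} t_{1,n-k}}`.
Here `t_{p,q}` is the transposition of `p` and `q`.  The Schubert polynomials are
encoded as any family `S` satisfying their defining properties (`hS0`, `hSrec`). -/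
theorem stmt6 (n : ℕ) (hn : 2 < n)
    (S : Equiv.Perm ℕ → MvPolynomial ℕ ℤ)
    (hS0 : S (revPerm n) = ∏ r ∈ Finset.Icc 1 (n - 1), X r ^ (n - r))
    (hSrec : ∀ w : Equiv.Perm ℕ, (∀ x, x ∉ Finset.Icc 1 n → w x = x) →
      ∀ r, 1 ≤ r → r < n → w (r + 1) < w r →
        S w - rename (⇑(Equiv.swap r (r + 1))) (S w)
          = (X r - X (r + 1)) * S (w * Equiv.swap r (r + 1))) :
    S (Equiv.swap 1 2) * S (wkij (n - 1) 1 1)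
        = S (wkij (n - 1) 1 1 * Equiv.swap 1 n) ∧
    ∀ k, 2 ≤ k → k ≤ n - 2 →
      S (Equiv.swap 1 2) * S (wkij (n - 1) 1 k)
        = S (wkij (n - 1) 1 k * Equiv.swap 1 (n - k)) := by
  have hS : SchubertRec n S := hSrec
  rw [hS.swap_one_two hS0 hn.le]
  refine ⟨hS.X_one_mul_wkij hS0 le_rfl (by omega) ?_, fun k hk2 hkn =>
    hS.X_one_mul_wkij hS0 (by omega) (by omega) ?_⟩
  · rw [wkij_apply le_rfl (by omega)]
    split_ifs <;> omega
  · rw [wkij_apply (by omega) (by omega)]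
    split_ifs <;> omega
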